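/- arXiv:2211.11429 — 2 statements merged into one kernel-verified Lean document; each statement's English description precedes it below -/
import Mathlib

section
/- Let A be a finite-dimensional real algebra. If A is spanned (as a real vector space) by a compact subgroup of its group of units A^×, then A is semisimple; conversely, every finite-dimensional semisimple real algebra is spanned by a compact subgroup of its unit group. -/
open MeasureTheory in
theorem semisimple_of_compact_span
    {A : Type*} [NormedRing A] [NormedAlgebra ℝ A] [FiniteDimensional ℝ A]
    (G : Subgroup Aˣ)
    (hG : IsCompact (((↑) : Aˣ → A) '' (G : Set Aˣ)))
    (hs : Submodule.span ℝ (((↑) : Aˣ → A) '' (G : Set Aˣ)) = ⊤) :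
    IsSemisimpleRing A := by
  haveI : CompleteSpace A := FiniteDimensional.complete ℝ A
  have hGc : IsCompact (G : Set Aˣ) :=
    (Units.isOpenEmbedding_val (R := A)).isInducing.isCompact_iff.2 hG
  haveI : CompactSpace G := isCompact_iff_compactSpace.1 hGc
  letI : MeasurableSpace G := borel G
  haveI : BorelSpace G := ⟨rfl⟩
  let μ : Measure G := Measure.haarMeasure ⊤
  haveI : IsProbabilityMeasure μ := ⟨by
    have := Measure.haarMeasure_self (G := G) (K₀ := ⊤)
    simpa using this⟩
  have hv : Continuous (fun g : G => ((g : Aˣ) : A)) :=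
    Units.continuous_val.comp continuous_subtype_val
  have hvi : Continuous (fun g : G => (((g : Aˣ)⁻¹ : Aˣ) : A)) :=
    Units.continuous_val.comp (continuous_inv.comp continuous_subtype_val)
  suffices h : ComplementedLattice (Submodule A A) from { toComplementedLattice := h }
  refine ⟨fun I => ?_⟩
  obtain ⟨q, hq⟩ := (I.restrictScalars ℝ).subtype.exists_leftInverse_of_injective
    (by ext x; simp)
  let p : A →L[ℝ] A := LinearMap.toContinuousLinearMap ((I.restrictScalars ℝ).subtype ∘ₗ q)
  have hpI : ∀ x, p x ∈ I := fun x => (q x).2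
  have hpid : ∀ x ∈ I, p x = x := fun x hx => by
    have := LinearMap.congr_fun hq ⟨x, hx⟩
    simpa [p] using congrArg Subtype.val this
  let F : A → G → A := fun x g => (g : Aˣ) * p ((((g : Aˣ)⁻¹ : Aˣ) : A) * x)
  have hFc : ∀ x, Continuous (F x) := fun x =>
    hv.mul (p.continuous.comp (hvi.mul continuous_const))
  have hFi : ∀ x, Integrable (F x) μ := fun x =>
    (hFc x).integrable_of_hasCompactSupport (HasCompactSupport.of_compactSpace _)
  have hFI : ∀ x g, F x g ∈ I := fun x g => I.smul_mem _ (hpI _)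
  let T : A →ₗ[ℝ] A :=
    { toFun := fun x => ∫ g, F x g ∂μ
      map_add' := fun x y => by
        rw [← integral_add (hFi x) (hFi y)]
        congr 1; ext g; simp [F, mul_add]
      map_smul' := fun c x => by
        rw [RingHom.id_apply, ← integral_smul]
        congr 1; ext g; simp [F] }
  have hT : ∀ x, T x = ∫ g, F x g ∂μ := fun x => rfl
  have hTG : ∀ (h : G) x, T (((h : Aˣ) : A) * x) = ((h : Aˣ) : A) * T x := fun h x => by
    have h1 := ((ContinuousLinearMap.mul ℝ A) ((h : Aˣ) : A)).integral_comp_comm (hFi x)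
    simp only [ContinuousLinearMap.mul_apply'] at h1
    rw [hT, hT, ← h1, ← integral_mul_left_eq_self _ h]
    congr 1; ext g
    simp [F, mul_assoc]
  have hTA : ∀ a x, T (a * x) = a * T x := fun a x => by
    have ha : a ∈ Submodule.span ℝ (((↑) : Aˣ → A) '' (G : Set Aˣ)) := hs ▸ Submodule.mem_top
    induction ha using Submodule.span_induction with
    | mem a ha => obtain ⟨u, hu, rfl⟩ := ha; exact hTG ⟨u, hu⟩ x
    | zero => simp
    | add a b _ _ h1 h2 => simp [add_mul, h1, h2]
    | smul c a _ h1 => simp [h1]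
  have hTI : ∀ x, T x ∈ I := fun x => by
    have h1 := p.integral_comp_comm (hFi x)
    simp only [hpid _ (hFI x _)] at h1
    rw [hT, h1]; exact hpI _
  have hTid : ∀ x ∈ I, T x = x := fun x hx => by
    have : ∀ g, F x g = x := fun g => by
      have : p ((((g : Aˣ)⁻¹ : Aˣ) : A) * x) = (((g : Aˣ)⁻¹ : Aˣ) : A) * x :=
        hpid _ (I.smul_mem _ hx)
      simp only [F, this, Units.mul_inv_cancel_left]
    rw [hT]; simp [this]
  let f : A →ₗ[A] I :=
    { toFun := fun x => ⟨T x, hTI x⟩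
      map_add' := fun x y => by ext; simp
      map_smul' := fun a x => by ext; simp [hTA] }
  exact ⟨_, LinearMap.isCompl_of_proj (f := f) fun x => by ext; exact hTid x x.2⟩

/-- `A` is spanned by a compact group of units containing `-1`. -/
def GoodAlg (A : Type*) [Ring A] [Algebra ℝ A] [TopologicalSpace A] : Prop :=
  ∃ S : Submonoid A, IsCompact (S : Set A) ∧ -1 ∈ S ∧
    (∀ x ∈ S, ∃ y ∈ S, x * y = 1 ∧ y * x = 1) ∧ Submodule.span ℝ (S : Set A) = ⊤

theorem GoodAlg.map {A B : Type*} [Ring A] [Algebra ℝ A] [TopologicalSpace A]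
    [Ring B] [Algebra ℝ B] [TopologicalSpace B] (h : GoodAlg A) (e : A ≃ₐ[ℝ] B)
    (he : Continuous e) : GoodAlg B := by
  obtain ⟨S, hc, h1, hi, hs⟩ := h
  refine ⟨S.map (e : A →* B), hc.image he, ⟨-1, h1, by simp⟩, ?_, ?_⟩
  · rintro _ ⟨x, hx, rfl⟩
    obtain ⟨y, hy, h1, h2⟩ := hi x hx
    refine ⟨e y, ⟨y, hy, rfl⟩, ?_, ?_⟩
    · simpa using congrArg e h1
    · simpa using congrArg e h2
  · have := congrArg (Submodule.map e.toLinearMap) hs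
    rw [Submodule.map_span, Submodule.map_top,
      LinearMap.range_eq_top.2 e.surjective] at this
    exact this

theorem GoodAlg.pi {ι : Type*} [Finite ι] {A : ι → Type*} [∀ i, Ring (A i)]
    [∀ i, Algebra ℝ (A i)] [∀ i, TopologicalSpace (A i)] (h : ∀ i, GoodAlg (A i)) :
    GoodAlg (∀ i, A i) := by
  classical
  cases nonempty_fintype ι
  choose S hc h1 hi hs using h
  refine ⟨Submonoid.pi Set.univ S, ?_, ?_, ?_, ?_⟩
  · exact isCompact_univ_pi hc
  · intro i _; exact h1 i
  · intro x hx
    choose y hy hy1 hy2 using fun i => hi i (x i) (hx i trivial)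
    exact ⟨y, fun i _ => hy i, funext hy1, funext hy2⟩
  · rw [eq_top_iff]
    rintro x -
    have key : ∀ i (d : A i), Pi.single i d ∈
        Submodule.span ℝ (Submonoid.pi Set.univ S : Set (∀ i, A i)) := by
      intro i d
      have hd : d ∈ Submodule.span ℝ (S i : Set (A i)) := hs i ▸ Submodule.mem_top
      induction hd using Submodule.span_induction with
      | zero => simp
      | add a b _ _ h1 h2 => rw [Pi.single_add]; exact add_mem h1 h2
      | smul c a _ h1 => rw [Pi.single_smul]; exact Submodule.smul_mem _ _ h1
      | mem a ha =>
        have hna : -a ∈ S i := by simpa using (S i).mul_mem (h1 i) ha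
        have hu : ∀ b ∈ S i, Function.update (1 : ∀ i, A i) i b ∈ Submonoid.pi Set.univ S := by
          intro b hb j _
          by_cases hj : j = i
          · subst hj; simpa using hb
          · simp [hj]
        have : Pi.single i a = (2⁻¹ : ℝ) • (Function.update (1 : ∀ i, A i) i a -
            Function.update (1 : ∀ i, A i) i (-a)) := by
          ext j
          by_cases hj : j = i
          · subst hj
            simp [← two_smul ℝ a, smul_smul]
          · simp [hj]
        rw [this]
        exact Submodule.smul_mem _ _ (sub_mem (Submodule.subset_span (hu _ ha))
          (Submodule.subset_span (hu _ hna)))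
    rw [← Finset.univ_sum_single x]
    exact sum_mem fun i _ => key i _

/-- monomial matrix -/
def monoMat {n : Type*} [DecidableEq n] {D : Type*} [Zero D]
    (σ : Equiv.Perm n) (k : n → D) : Matrix n n D :=
  Matrix.of fun i j => if j = σ i then k i else 0

theorem monoMat_mul {n : Type*} [Fintype n] [DecidableEq n] {D : Type*} [Ring D]
    (σ τ : Equiv.Perm n) (k l : n → D) :
    monoMat σ k * monoMat τ l = monoMat (τ * σ) (fun i => k i * l (σ i)) := by
  ext i j
  rw [Matrix.mul_apply, Finset.sum_eq_single (σ i)]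
  · by_cases hj : j = τ (σ i) <;> simp [monoMat, hj]
  · intro m _ hm
    simp [monoMat, hm]
  · simp

theorem monoMat_one {n : Type*} [DecidableEq n] {D : Type*} [Ring D] :
    monoMat (1 : Equiv.Perm n) (1 : n → D) = 1 := by
  ext i j
  simp [monoMat, Matrix.one_apply, eq_comm]

theorem GoodAlg.matrix {n : Type*} [Fintype n] [DecidableEq n] {D : Type*} [Ring D]
    [Algebra ℝ D] [TopologicalSpace D] (h : GoodAlg D) : GoodAlg (Matrix n n D) := by
  obtain ⟨S, hc, h1, hi, hs⟩ := h
  let T : Submonoid (Matrix n n D) :=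
    { carrier := {x | ∃ σ k, (∀ i, k i ∈ S) ∧ monoMat σ k = x}
      one_mem' := ⟨1, 1, fun _ => S.one_mem, monoMat_one⟩
      mul_mem' := by
        rintro _ _ ⟨σ, k, hk, rfl⟩ ⟨τ, l, hl, rfl⟩
        exact ⟨_, _, fun i => S.mul_mem (hk i) (hl (σ i)), (monoMat_mul σ τ k l).symm⟩ }
  refine ⟨T, ?_, ?_, ?_, ?_⟩
  · have : (T : Set (Matrix n n D)) =
        ⋃ σ : Equiv.Perm n, monoMat σ '' (Set.univ.pi fun _ => (S : Set D)) := by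
      ext x
      simp [T, Set.mem_pi]
    rw [this]
    refine isCompact_iUnion fun σ => (isCompact_univ_pi fun _ => hc).image ?_
    refine continuous_matrix fun i j => ?_
    by_cases hj : j = σ i
    · simpa [monoMat, hj] using continuous_apply i
    · simpa [monoMat, hj] using continuous_const
  · refine ⟨1, fun _ => -1, fun _ => h1, ?_⟩
    rw [← monoMat_one]
    ext i j
    by_cases hj : j = i <;> simp [monoMat, hj]
  · rintro _ ⟨σ, k, hk, rfl⟩
    choose y hy hy1 hy2 using fun i => hi (k i) (hk i)
    refine ⟨_, ⟨σ⁻¹, fun i => y (σ⁻¹ i), fun i => hy _, rfl⟩, ?_, ?_⟩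
    · rw [monoMat_mul, ← monoMat_one]
      congr 1
      · simp
      · ext i; simp [hy1]
    · rw [monoMat_mul, ← monoMat_one]
      congr 1
      · simp
      · ext i; simp [hy2]
  · rw [eq_top_iff]
    rintro x -
    have key : ∀ i j (d : D), Matrix.single i j d ∈
        Submodule.span ℝ (T : Set (Matrix n n D)) := by
      intro i j d
      have hd : d ∈ Submodule.span ℝ (S : Set D) := hs ▸ Submodule.mem_top
      induction hd using Submodule.span_induction with
      | zero => simp
      | add a b _ _ h1 h2 => rw [Matrix.single_add]; exact add_mem h1 h2
      | smul c a _ h1 => rw [← Matrix.smul_single]; exact Submodule.smul_mem _ _ h1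
      | mem a ha =>
        have hna : -a ∈ S := by simpa using S.mul_mem h1 ha
        have hu : ∀ b ∈ S, monoMat (Equiv.swap i j) (Function.update (1 : n → D) i b) ∈ T := by
          intro b hb
          refine ⟨_, _, fun m => ?_, rfl⟩
          by_cases hj : m = i
          · subst hj; simpa using hb
          · simp [hj]
        have : Matrix.single i j a = (2⁻¹ : ℝ) •
            (monoMat (Equiv.swap i j) (Function.update (1 : n → D) i a) -
            monoMat (Equiv.swap i j) (Function.update (1 : n → D) i (-a))) := by
          ext r c
          by_cases hr : r = i
          · subst hr
            by_cases hcj : c = j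
            · subst hcj
              simp [monoMat, ← two_smul ℝ a, smul_smul]
            · simp [monoMat, hcj, Ne.symm hcj]
          · simp [monoMat, hr, Ne.symm hr]
        rw [this]
        exact Submodule.smul_mem _ _ (sub_mem (Submodule.subset_span (hu _ ha))
          (Submodule.subset_span (hu _ hna)))
    rw [Matrix.matrix_eq_sum_single x]
    exact sum_mem fun i _ => sum_mem fun j _ => key i j _

theorem GoodAlg.division {D : Type*} [DivisionRing D] [Algebra ℝ D] [FiniteDimensional ℝ D]
    [TopologicalSpace D] [IsModuleTopology ℝ D] : GoodAlg D := by
  haveI : ContinuousAdd D := IsModuleTopology.toContinuousAdd ℝ D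
  let b := Module.finBasis ℝ D
  set n := Module.finrank ℝ D with hn
  have hn0 : n ≠ 0 := Module.finrank_pos.ne'
  let N : D →* ℝ := Algebra.norm ℝ
  have hNc : Continuous N := by
    have : (N : D → ℝ) = fun s => (Algebra.leftMulMatrix b s).det :=
      funext fun s => Algebra.norm_eq_matrix_det b s
    rw [this]
    exact (IsModuleTopology.continuous_of_linearMap
      (Algebra.leftMulMatrix b).toLinearMap).matrix_det
  have hN0 : ∀ d : D, d ≠ 0 → N d ≠ 0 := fun d hd h => by
    have := congrArg N (mul_inv_cancel₀ hd)
    simp [h] at this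
  have hNs : ∀ (r : ℝ) (d : D), N (r • d) = r ^ n * N d := fun r d => by
    rw [Algebra.smul_def, map_mul]
    congr 1
    exact Algebra.norm_algebraMap r
  let φ : D ≃ₗ[ℝ] (Fin n → ℝ) := b.equivFun
  let s : D → D := fun d => (|N d| ^ (-(1 / n : ℝ))) • d
  have hsN : ∀ d : D, d ≠ 0 → |N (s d)| = 1 := fun d hd => by
    have h0 : 0 < |N d| := abs_pos.2 (hN0 d hd)
    simp only [s, hNs, abs_mul, abs_pow, abs_of_pos (Real.rpow_pos_of_pos h0 _)]
    rw [← Real.rpow_mul_natCast h0.le]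
    have : -(1 / n : ℝ) * n = -1 := by field_simp
    rw [this, Real.rpow_neg_one, inv_mul_cancel₀ h0.ne']
  let K : Submonoid D :=
    { carrier := {d | |N d| = 1}
      one_mem' := by simp
      mul_mem' := fun {a b} ha hb => by
        simp only [Set.mem_setOf_eq] at *
        simp [abs_mul, ha, hb] }
  have hK0 : ∀ d ∈ K, d ≠ 0 := fun d hd h => by
    have h1 : |N d| = 1 := hd
    have h2 := hNs 0 0
    simp [h, hn0] at h2 h1
    simp [h2] at h1
  refine ⟨K, ?_, ?_, ?_, ?_⟩
  · have hC : IsCompact (φ.symm '' Metric.sphere 0 1) :=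
      (isCompact_sphere _ _).image (IsModuleTopology.continuous_of_linearMap φ.symm.toLinearMap)
    have hCne : ∀ d ∈ φ.symm '' Metric.sphere 0 1, d ≠ 0 := by
      rintro _ ⟨v, hv, rfl⟩ h
      have : v = 0 := by simpa using h
      simp [this] at hv
    have hs : ContinuousOn s (φ.symm '' Metric.sphere 0 1) := by
      refine ContinuousOn.smul (ContinuousOn.rpow_const hNc.abs.continuousOn fun d hd => ?_)
        continuousOn_id
      exact Or.inl (abs_pos.2 (hN0 d (hCne d hd))).ne'
    convert hC.image_of_continuousOn hs
    ext d
    constructor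
    · intro hd
      have hd0 := hK0 d hd
      have hr : 0 < ‖φ d‖ := norm_pos_iff.2 (by simpa using hd0)
      have hd1 : |N d| = 1 := hd
      refine ⟨‖φ d‖⁻¹ • d, ⟨‖φ d‖⁻¹ • φ d, ?_, by simp⟩, ?_⟩
      · simp [norm_smul, hr.ne']
      · have hi : 0 < ‖φ d‖⁻¹ := inv_pos.2 hr
        simp only [s, hNs, abs_mul, hd1, mul_one, abs_pow, abs_of_pos hi]
        rw [← Real.rpow_natCast_mul hi.le]
        have : (n : ℝ) * -(1 / n : ℝ) = -1 := by field_simp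
        rw [this, Real.rpow_neg_one, inv_inv, smul_smul, mul_inv_cancel₀ hr.ne', one_smul]
    · rintro ⟨u, hu, rfl⟩
      exact hsN u (hCne u hu)
  · have := hNs (-1) 1
    simp only [neg_smul, one_smul, map_one, mul_one] at this
    change |N (-1)| = 1
    simp [this]
  · intro x hx
    have hx0 := hK0 x hx
    refine ⟨x⁻¹, ?_, mul_inv_cancel₀ hx0, inv_mul_cancel₀ hx0⟩
    change |N x⁻¹| = 1
    have := congrArg (fun y => |N y|) (mul_inv_cancel₀ hx0)
    have hx1 : |N x| = 1 := hx
    simpa [abs_mul, hx1] using this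
  · rw [eq_top_iff]
    rintro d -
    by_cases hd : d = 0
    · simp [hd]
    · have h0 : 0 < |N d| := abs_pos.2 (hN0 d hd)
      have h1 := (Real.rpow_pos_of_pos h0 (-(1 / n : ℝ))).ne'
      have : d = (|N d| ^ (-(1 / n : ℝ)))⁻¹ • s d := by
        simp only [s]
        rw [smul_smul, inv_mul_cancel₀ h1, one_smul]
      rw [this]
      exact Submodule.smul_mem _ _ (Submodule.subset_span (hsN d hd))

theorem compact_span_of_semisimple
    {A : Type*} [NormedRing A] [NormedAlgebra ℝ A] [FiniteDimensional ℝ A]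
    [IsSemisimpleRing A] : GoodAlg A := by
  obtain ⟨n, D, d, _, _, _, _, ⟨e⟩⟩ :=
    IsSemisimpleRing.exists_algEquiv_pi_matrix_divisionRing_finite ℝ A
  letI : ∀ i, TopologicalSpace (D i) := fun i => moduleTopology ℝ (D i)
  haveI : ∀ i, IsModuleTopology ℝ (D i) := fun i => ⟨rfl⟩
  haveI : ∀ i, IsModuleTopology ℝ (Matrix (Fin (d i)) (Fin (d i)) (D i)) := fun i =>
    inferInstanceAs (IsModuleTopology ℝ (Fin (d i) → Fin (d i) → D i))
  exact (GoodAlg.pi fun i => GoodAlg.matrix (GoodAlg.division (D := D i))).map e.symm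
    (IsModuleTopology.continuous_of_linearMap e.symm.toLinearMap)

/-- A finite-dimensional real (normed) algebra `A` is spanned, as a real
vector space, by a compact subgroup of its unit group `A^×` if and only if `A` is
semisimple. -/
theorem spanned_by_compact_subgroup_iff_semisimple
    {A : Type*} [NormedRing A] [NormedAlgebra ℝ A] [FiniteDimensional ℝ A] :
    (∃ G : Subgroup Aˣ,
        IsCompact (((↑) : Aˣ → A) '' (G : Set Aˣ)) ∧
        Submodule.span ℝ (((↑) : Aˣ → A) '' (G : Set Aˣ)) = ⊤) ↔
      IsSemisimpleRing A := by
  constructor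
  · rintro ⟨G, hG, hs⟩
    exact semisimple_of_compact_span G hG hs
  · intro _
    obtain ⟨S, hc, -, hi, hs⟩ := compact_span_of_semisimple (A := A)
    let G : Subgroup Aˣ :=
      { carrier := {u | (u : A) ∈ S ∧ ((u⁻¹ : Aˣ) : A) ∈ S}
        one_mem' := by simp
        mul_mem' := fun {a b} ha hb => by
          refine ⟨by simpa using S.mul_mem ha.1 hb.1, by simpa using S.mul_mem hb.2 ha.2⟩
        inv_mem' := fun {a} ha => ⟨ha.2, by simpa using ha.1⟩ }
    have hGS : ((↑) : Aˣ → A) '' (G : Set Aˣ) = (S : Set A) := by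
      ext x
      constructor
      · rintro ⟨u, hu, rfl⟩; exact hu.1
      · intro hx
        obtain ⟨y, hy, h1, h2⟩ := hi x hx
        exact ⟨⟨x, y, h1, h2⟩, ⟨hx, hy⟩, rfl⟩
    exact ⟨G, hGS ▸ hc, hGS ▸ hs⟩
end

section
/- Let A and B be unital C*-algebras with A finite-dimensional, and let φ, ψ: A → B be unital *-homomorphisms. If ‖φ − ψ‖ is sufficiently small (depending on A), then φ and ψ are unitarily conjugate: there exists a unitary u ∈ B with ψ(a) = u·φ(a)·u* for all a ∈ A. -/
universe u

/-- Polar decomposition of an invertible element, with control of the commutant. -/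
lemma polar_aux {B : Type u} [CStarAlgebra B] (x : B) (hx : IsUnit x) :
    ∃ h : B, x * h ∈ unitary B ∧ ∀ b : B, Commute (star x * x) b → Commute h b := by
  let _ := CStarAlgebra.spectralOrder B
  let _ := CStarAlgebra.spectralOrderedRing B
  have hp : IsStrictlyPositive (star x * x) :=
    IsStrictlyPositive.iff_of_unital.2 ⟨star_mul_self_nonneg x, hx.star.mul hx⟩
  have h0 : (0 : B) ≤ (star x * x) ^ (-(1 / 2) : ℝ) := CFC.rpow_nonneg
  have hsa : star ((star x * x) ^ (-(1 / 2) : ℝ)) = (star x * x) ^ (-(1 / 2) : ℝ) :=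
    (IsSelfAdjoint.of_nonneg h0).star_eq
  have hconj := CFC.conjugate_rpow_neg_one_half (star x * x) hp
  have hu : IsUnit (x * (star x * x) ^ (-(1 / 2) : ℝ)) :=
    hx.mul (hp.isUnit.cfcRpow _ hp.nonneg)
  refine ⟨(star x * x) ^ (-(1 / 2) : ℝ), ?_, ?_⟩
  · have h1 : star (x * (star x * x) ^ (-(1 / 2) : ℝ)) * (x * (star x * x) ^ (-(1 / 2) : ℝ)) = 1 := by
      rw [star_mul, hsa]
      simpa [mul_assoc] using hconj
    refine Unitary.mem_iff.2 ⟨h1, ?_⟩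
    obtain ⟨w, hw⟩ := hu
    rw [← hw] at h1 ⊢
    have : star (w : B) = (↑w⁻¹ : B) := by
      rw [← Units.mul_left_inj w, h1]; simp
    rw [this]; simp
  · intro b hb
    rw [CFC.rpow_def]
    exact hb.cfc_nnreal _

open MeasureTheory in
/-- The averaged intertwiner. -/
lemma intertwiner_aux {A B : Type u} [CStarAlgebra A] [FiniteDimensional ℂ A] [CStarAlgebra B]
    (φ ψ : A →⋆ₐ[ℂ] B) (h : ∀ a : A, ‖φ a - ψ a‖ ≤ (1 / 2) * ‖a‖) :
    ∃ x : B, ‖x - 1‖ ≤ 1 / 2 ∧ ∀ a : A, ψ a * x = x * φ a := by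
  have hproper : ProperSpace A := FiniteDimensional.proper ℂ A
  have hnorm : ∀ v : unitary A, ‖(v : A)‖ ≤ 1 := fun v => by
    rcases subsingleton_or_nontrivial A with hA | hA
    · simp [Subsingleton.elim (v : A) 0]
    · exact (CStarRing.norm_coe_unitary v).le
  have hcomp : IsCompact (unitary A : Set A) := by
    refine Metric.isCompact_of_isClosed_isBounded isClosed_unitary ?_
    refine (Metric.isBounded_closedBall (x := (0 : A)) (r := 1)).subset ?_
    intro v hv
    simpa using hnorm ⟨v, hv⟩
  have : CompactSpace (unitary A) := isCompact_iff_compactSpace.1 hcomp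
  let _ : MeasurableSpace (unitary A) := borel _
  have : BorelSpace (unitary A) := ⟨rfl⟩
  let μ : Measure (unitary A) := Measure.haarMeasure ⊤
  have : IsProbabilityMeasure μ := ⟨by
    simpa using Measure.haarMeasure_self (K₀ := (⊤ : TopologicalSpace.PositiveCompacts (unitary A)))⟩
  have hφ : Continuous φ := φ.toAlgHom.toLinearMap.continuous_of_finiteDimensional
  have hψ : Continuous ψ := ψ.toAlgHom.toLinearMap.continuous_of_finiteDimensional
  let f : unitary A → B := fun v => ψ (v : A) * φ (star (v : A))
  have hf : Continuous f := by fun_prop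
  have hint : Integrable f μ :=
    hf.integrable_of_hasCompactSupport (HasCompactSupport.of_compactSpace f)
  refine ⟨∫ v, f v ∂μ, ?_, ?_⟩
  · have h1 : (∫ v, f v ∂μ) - 1 = ∫ v, (f v - 1) ∂μ := by
      rw [integral_sub hint (integrable_const _)]; simp
    rw [h1]
    refine (norm_integral_le_of_norm_le_const (C := 1 / 2) (Filter.Eventually.of_forall ?_)).trans (by simp)
    intro v
    have h2 : f v - 1 = (ψ (v : A) - φ (v : A)) * φ (star (v : A)) := by
      have : φ (v : A) * φ (star (v : A)) = 1 := by
        rw [← map_mul, Unitary.mul_star_self_of_mem v.2, map_one]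
      rw [sub_mul, this]
    have h3 : ‖φ (star (v : A))‖ ≤ 1 :=
      (NonUnitalStarAlgHom.norm_apply_le φ _).trans (by rw [norm_star]; exact hnorm v)
    have h4 := h (v : A)
    have h5 := hnorm v
    rw [h2]
    refine (norm_mul_le _ _).trans ?_
    rw [norm_sub_rev]
    nlinarith [norm_nonneg (φ (star (v : A))), norm_nonneg (φ (v : A) - ψ (v : A))]
  · have hunit : ∀ w : unitary A, ψ (w : A) * (∫ v, f v ∂μ) = (∫ v, f v ∂μ) * φ (w : A) := by
      intro w
      have e1 : ∫ v, f (w * v) ∂μ = ∫ v, f v ∂μ := integral_mul_left_eq_self f w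
      have e2 : ∀ v, f (w * v) = ψ (w : A) * f v * φ (star (w : A)) := by
        intro v
        simp [f, mul_assoc]
      simp_rw [e2] at e1
      have e3 : ∫ v, ψ (w : A) * f v * φ (star (w : A)) ∂μ
          = ψ (w : A) * (∫ v, f v ∂μ) * φ (star (w : A)) := by
        have := ((ContinuousLinearMap.mul ℂ B (ψ (w : A))).integral_comp_comm hint)
        have h6 := (((ContinuousLinearMap.mul ℂ B).flip (φ (star (w : A)))).integral_comp_comm
          (hint.const_mul (ψ (w : A))))
        simp only [ContinuousLinearMap.mul_apply', ContinuousLinearMap.flip_apply] at this h6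
        rw [h6, this]
      rw [e3] at e1
      have h7 : φ (star (w : A)) * φ (w : A) = 1 := by
        rw [← map_mul, Unitary.star_mul_self_of_mem w.2, map_one]
      conv_rhs => rw [← e1, mul_assoc, h7, mul_one]
    intro a
    have ha : a ∈ Submodule.span ℂ (unitary A : Set A) := by
      rw [CStarAlgebra.span_unitary]; trivial
    induction ha using Submodule.span_induction with
    | mem y hy => exact hunit ⟨y, hy⟩
    | zero => simp
    | add y z _ _ hy hz => rw [map_add, map_add, add_mul, mul_add, hy, hz]
    | smul c y _ hy => rw [map_smul, map_smul, smul_mul_assoc, mul_smul_comm, hy]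

lemma conj_aux {A B : Type u} [CStarAlgebra A] [FiniteDimensional ℂ A] [CStarAlgebra B]
    (φ ψ : A →⋆ₐ[ℂ] B) (h : ∀ a : A, ‖φ a - ψ a‖ ≤ (1 / 2) * ‖a‖) :
    ∃ u : B, u ∈ unitary B ∧ ∀ a : A, ψ a = u * φ a * star u := by
  obtain ⟨x, hx1, hx⟩ := intertwiner_aux φ ψ h
  have hxu : IsUnit x := by
    have := isUnit_one_sub_of_norm_lt_one (x := 1 - x) (by rw [norm_sub_rev]; linarith)
    simpa using this
  obtain ⟨k, hk, hc⟩ := polar_aux x hxu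
  have hstar : ∀ a, star x * ψ a = φ a * star x := by
    intro a
    have := congrArg star (hx (star a))
    simpa [map_star] using this
  refine ⟨x * k, hk, fun a => ?_⟩
  have hcomm : Commute (star x * x) (φ a) := by
    change star x * x * φ a = φ a * (star x * x)
    rw [mul_assoc, ← hx, ← mul_assoc, hstar, mul_assoc]
  have h1 : x * k * φ a = ψ a * (x * k) := by
    rw [mul_assoc, (hc _ hcomm).eq, ← mul_assoc, ← hx, mul_assoc]
  rw [h1, mul_assoc, Unitary.mul_star_self_of_mem hk, mul_one]

/-- Let `A` be a finite-dimensional unital C*-algebra.  There is an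
`ε > 0` (depending only on `A`) such that for every unital C*-algebra `B` and all
unital *-homomorphisms `φ, ψ : A → B` with `‖φ - ψ‖ ≤ ε`, the morphisms `φ` and `ψ`
are unitarily conjugate: `ψ(a) = u·φ(a)·u*` for a unitary `u ∈ B`. -/
theorem close_cstar_morphisms_unitarily_conjugate
    {A : Type u} [NormedRing A] [StarRing A] [CStarRing A] [NormedAlgebra ℂ A]
    [CompleteSpace A] [StarModule ℂ A] [FiniteDimensional ℂ A] :
    ∃ ε : ℝ, 0 < ε ∧
      ∀ (B : Type u) [NormedRing B] [StarRing B] [CStarRing B] [NormedAlgebra ℂ B]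
        [CompleteSpace B] [StarModule ℂ B],
        ∀ φ ψ : A →⋆ₐ[ℂ] B,
          (∀ a : A, ‖φ a - ψ a‖ ≤ ε * ‖a‖) →
          ∃ u : B, u ∈ unitary B ∧ ∀ a : A, ψ a = u * φ a * star u := by
  refine ⟨1 / 2, by norm_num, ?_⟩
  intro B _ _ _ _ _ _ φ ψ h
  let _ : CStarAlgebra A := {}
  let _ : CStarAlgebra B := {}
  exact conj_aux φ ψ h
end
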